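/- Complete reduction to two terminal graphs (Proposition 4.10). Let G be a finite connected simple graph and let x, y, z ∈ V(G) be three distinct vertices. Assume G is 3-connected to {x,y,z}, every vertex in V(G) ∖ {x,y,z} has degree 3, and x, y, z each have degree exactly 2. Then there is a finite sequence G = G₀, G₁, …, G_k in which each G_{i+1} is the H-reduction of G_i by an edge that is strongly H-reducible for G_i and {x,y,z}, such that G_k is either (a) the triangle with vertex set {x,y,z} and edges {x,y}, {y,z}, {x,z}, or (b) the graph with vertex set {x,y,z,v,v'} for two further distinct vertices v, v', whose edge set is exactly {{s,w} : s ∈ {x,y,z}, w ∈ {v,v'}} (i.e., the complete bipartite graph with parts {x,y,z} and {v,v'}). -/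

import Mathlib

open scoped Classical

/-- A finite multigraph on a vertex type `V`: a finite vertex set together with
an edge-multiplicity function on unordered pairs, supported on pairs of vertices. -/
structure Multigraph (V : Type) where
  verts : Finset V
  mult : Sym2 V → ℕ
  supp : ∀ e : Sym2 V, mult e ≠ 0 → ∀ v ∈ e, v ∈ verts

namespace Multigraph

variable {V : Type}

/-- The multiset of neighbours of `x`, counted with edge multiplicity. -/
def nbrs (G : Multigraph V) (x : V) : Multiset V :=
  G.verts.val.bind fun u => Multiset.replicate (G.mult s(x, u)) u

/-- The (edge-)degree of a vertex: the number of edges incident to it. -/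
def deg (G : Multigraph V) (x : V) : ℕ := (G.nbrs x).card

/-- Adjacency: `a ≠ b` and at least one edge joins `a` and `b`. -/
def Adj (G : Multigraph V) (a b : V) : Prop := a ≠ b ∧ G.mult s(a, b) ≠ 0

/-- A multigraph is simple if all multiplicities are at most one and there
are no self-loops. -/
def IsSimple (G : Multigraph V) : Prop :=
  (∀ e : Sym2 V, G.mult e ≤ 1) ∧ ∀ v : V, G.mult s(v, v) = 0

/-- Connectivity of a multigraph. -/
def Connected (G : Multigraph V) : Prop :=
  G.verts.Nonempty ∧ ∀ u ∈ G.verts, ∀ v ∈ G.verts, Relation.ReflTransGen G.Adj u v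

/-- The number of edges (counted with multiplicity). -/
def numEdges (G : Multigraph V) : ℕ := ∑ e ∈ G.verts.sym2, G.mult e

end Multigraph

/-- The list of (unordered) edges traversed by a list of vertices. -/
def listEdges {V : Type} (l : List V) : List (Sym2 V) :=
  (l.zip l.tail).map fun p => s(p.1, p.2)

namespace Multigraph

variable {V : Type}

/-- `l` is a (simple) path in `G`: a nonempty list of distinct vertices of `G`
in which consecutive vertices are adjacent. -/
def IsPathList (G : Multigraph V) (l : List V) : Prop :=
  l ≠ [] ∧ l.Nodup ∧ (∀ v ∈ l, v ∈ G.verts) ∧ l.Chain' G.Adj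

/-- `l` is a simple path in `G` from `a` to `b`. -/
def IsPathBetween (G : Multigraph V) (a b : V) (l : List V) : Prop :=
  G.IsPathList l ∧ l.head? = some a ∧ l.getLast? = some b

/-- `x` is 3-connected to `{s₁, s₂, s₃}`: there are three pairwise edge-disjoint
paths from `x` to `s₁`, `s₂` and `s₃` respectively. -/
def ThreeConnFrom (G : Multigraph V) (s₁ s₂ s₃ x : V) : Prop :=
  ∃ l₁ l₂ l₃ : List V,
    G.IsPathBetween x s₁ l₁ ∧ G.IsPathBetween x s₂ l₂ ∧ G.IsPathBetween x s₃ l₃ ∧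
    (listEdges l₁).Disjoint (listEdges l₂) ∧
    (listEdges l₁).Disjoint (listEdges l₃) ∧
    (listEdges l₂).Disjoint (listEdges l₃)

/-- `G` is 3-connected to `{s₁, s₂, s₃}`: every vertex outside `{s₁, s₂, s₃}`
is 3-connected to `{s₁, s₂, s₃}`. -/
def ThreeConnTo (G : Multigraph V) (s₁ s₂ s₃ : V) : Prop :=
  ∀ x ∈ G.verts, x ≠ s₁ → x ≠ s₂ → x ≠ s₃ → G.ThreeConnFrom s₁ s₂ s₃ x

/-- The edge `{x, y}` is H-reducible: `x` and `y` both have degree at least 3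
and are joined by exactly one edge. -/
def HReducible (G : Multigraph V) (x y : V) : Prop :=
  x ∈ G.verts ∧ y ∈ G.verts ∧ x ≠ y ∧ G.mult s(x, y) = 1 ∧
    3 ≤ G.deg x ∧ 3 ≤ G.deg y

/-- `G'` is the H-reduction of `G` by the H-reducible edge `{x, y}`:
if `x` (resp. `y`) has degree `3` it is deleted and its two remaining
neighbours get joined by a new edge `e_{x∖y}` (resp. `e_{y∖x}`); a vertex of
degree at least `4` is kept; if both have degree at least `4`, only the edge
`{x, y}` is deleted. -/
def IsHReductionBy (G : Multigraph V) (x y : V) (G' : Multigraph V) : Prop :=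
  G.HReducible x y ∧
    ((G.deg x = 3 ∧ G.deg y = 3 ∧
        ∃ z₁ z₂ t₁ t₂ : V,
          G.nbrs x = {y, z₁, z₂} ∧ G.nbrs y = {x, t₁, t₂} ∧
          (∀ v : V, v ∈ G'.verts ↔ v ∈ G.verts ∧ v ≠ x ∧ v ≠ y) ∧
          ∀ e : Sym2 V, G'.mult e =
            (if x ∈ e ∨ y ∈ e then 0 else G.mult e)
              + (if e = s(z₁, z₂) then 1 else 0)
              + (if e = s(t₁, t₂) then 1 else 0)) ∨
     (G.deg x = 3 ∧ 4 ≤ G.deg y ∧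
        ∃ z₁ z₂ : V, G.nbrs x = {y, z₁, z₂} ∧
          (∀ v : V, v ∈ G'.verts ↔ v ∈ G.verts ∧ v ≠ x) ∧
          ∀ e : Sym2 V, G'.mult e =
            (if x ∈ e then 0 else G.mult e) + (if e = s(z₁, z₂) then 1 else 0)) ∨
     (G.deg y = 3 ∧ 4 ≤ G.deg x ∧
        ∃ t₁ t₂ : V, G.nbrs y = {x, t₁, t₂} ∧
          (∀ v : V, v ∈ G'.verts ↔ v ∈ G.verts ∧ v ≠ y) ∧
          ∀ e : Sym2 V, G'.mult e =
            (if y ∈ e then 0 else G.mult e) + (if e = s(t₁, t₂) then 1 else 0)) ∨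
     (4 ≤ G.deg x ∧ 4 ≤ G.deg y ∧
        (∀ v : V, v ∈ G'.verts ↔ v ∈ G.verts) ∧
        ∀ e : Sym2 V, G'.mult e = if e = s(x, y) then 0 else G.mult e))

end Multigraph

/-- A relation walk can be shortened to a list without repeated entries. -/
theorem exists_nodup_isChain {V : Type} {r : V → V → Prop} {a b : V}
    (h : Relation.ReflTransGen r a b) :
    ∃ l : List V, l.Nodup ∧ l.IsChain r ∧ l.head? = some a ∧ l.getLast? = some b := by
  induction h using Relation.ReflTransGen.head_induction_on with
  | refl => exact ⟨[b], by simp⟩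
  | head hac _ ih =>
    rename_i a c _
    obtain ⟨l, hn, hc, hh, hl⟩ := ih
    by_cases ha : a ∈ l
    · obtain ⟨l₁, l₂, rfl⟩ := List.append_of_mem ha
      refine ⟨a :: l₂, (List.nodup_append.1 hn).2.1, (List.isChain_append.1 hc).2.1, rfl, ?_⟩
      simpa [List.getLast?_append] using hl
    · refine ⟨a :: l, List.nodup_cons.2 ⟨ha, hn⟩, ?_, rfl, ?_⟩
      · cases l with
        | nil => simp at hh
        | cons d l => simp at hh; subst hh; exact List.isChain_cons_cons.2 ⟨hac, hc⟩
      · cases l with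
        | nil => simp at hh
        | cons d l => simpa using hl

/-- The pairs of consecutive entries of a list. -/
def listArcs {V : Type} (l : List V) : List (V × V) := l.zip l.tail

theorem listArcs_cons_cons {V : Type} (a b : V) (l : List V) :
    listArcs (a :: b :: l) = (a, b) :: listArcs (b :: l) := rfl

theorem mem_left_of_mem_listArcs {V : Type} {l : List V} {p : V × V} (h : p ∈ listArcs l) :
    p.1 ∈ l := (List.of_mem_zip (a := p.1) (b := p.2) h).1

theorem mem_listEdges {V : Type} {l : List V} {e : Sym2 V} :
    e ∈ listEdges l ↔ ∃ p ∈ listArcs l, s(p.1, p.2) = e := by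
  simp [listEdges, listArcs]

theorem rel_of_mem_listArcs {V : Type} {r : V → V → Prop} {l : List V} (hl : l.IsChain r)
    {p : V × V} (h : p ∈ listArcs l) : r p.1 p.2 := by
  induction l with
  | nil => simp [listArcs] at h
  | cons a l ih =>
    cases l with
    | nil => simp [listArcs] at h
    | cons b l =>
      rw [List.isChain_cons_cons] at hl
      rw [listArcs_cons_cons, List.mem_cons] at h
      rcases h with rfl | h
      · exact hl.1
      · exact ih hl.2 h

theorem nodup_listArcs {V : Type} {l : List V} (hl : l.Nodup) : (listArcs l).Nodup := by
  induction l with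
  | nil => simp [listArcs]
  | cons a l ih =>
    cases l with
    | nil => simp [listArcs]
    | cons b l =>
      rw [List.nodup_cons] at hl
      rw [listArcs_cons_cons, List.nodup_cons]
      exact ⟨fun h => hl.1 (mem_left_of_mem_listArcs h), ih hl.2⟩

/-- The signed indicator function of the arcs traversed by a list. -/
noncomputable def listFlow {V : Type} (l : List V) (u v : V) : ℤ :=
  (listArcs l).count (u, v) - (listArcs l).count (v, u)

theorem sum_listFlow {V : Type} {l : List V} {A : Finset V} (hA : ∀ v ∈ l, v ∈ A) {a b : V}
    (ha : l.head? = some a) (hb : l.getLast? = some b) (u : V) :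
    ∑ v ∈ A, listFlow l u v = (if u = a then 1 else 0) - (if u = b then 1 else 0) := by
  induction l generalizing a with
  | nil => simp at ha
  | cons c l ih =>
    cases l with
    | nil =>
      simp at ha hb
      subst ha hb
      simp [listFlow, listArcs]
    | cons d l =>
      have := ih (fun v hv => hA v (List.mem_cons_of_mem _ hv)) rfl (by simpa using hb)
      simp at ha
      subst ha
      have hc := hA c (by simp)
      have hd := hA d (by simp)
      have key : ∀ v, listFlow (c :: d :: l) u v = listFlow (d :: l) u v +
          ((if d = v then (if u = c then 1 else 0) else 0) -
            (if c = v then (if u = d then 1 else 0) else 0)) := by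
        intro v
        simp only [listFlow, listArcs_cons_cons, List.count_cons, beq_iff_eq, Prod.mk.injEq,
          and_comm (a := c = u), eq_comm (a := u), ite_and]
        push_cast
        split_ifs <;> ring
      simp only [key, Finset.sum_add_distrib, this, Finset.sum_sub_distrib,
        Finset.sum_ite_eq, hc, hd, if_true]
      ring

namespace Multigraph

variable {V : Type}

/-- The number of edges with exactly one end in `X`. -/
noncomputable def cut (G : Multigraph V) (X : Finset V) : ℕ :=
  ∑ u ∈ X, ∑ v ∈ G.verts \ X, G.mult s(u, v)

/-- `φ` is an integral flow in `G` which sends `T.card` units from `a` to the vertices of `T`,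
one unit to each of them. -/
structure IsFlow (G : Multigraph V) (a : V) (T : Finset V) (φ : V → V → ℤ) : Prop where
  antisymm : ∀ u v, φ u v = -φ v u
  le_mult : ∀ u v, φ u v ≤ G.mult s(u, v)
  sum_eq : ∀ u ∈ G.verts, ∑ v ∈ G.verts, φ u v =
    (if u = a then (T.card : ℤ) else 0) - (if u ∈ T then 1 else 0)

theorem IsFlow.sum_leaving {G : Multigraph V} {a : V} {T : Finset V} {φ : V → V → ℤ}
    (h : G.IsFlow a T φ) {X : Finset V} (hX : X ⊆ G.verts) (ha : a ∈ X) :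
    ∑ u ∈ X, ∑ v ∈ G.verts \ X, φ u v = T.card - (X ∩ T).card := by
  have h0 : ∑ u ∈ X, ∑ v ∈ X, φ u v = 0 := by
    have : ∑ u ∈ X, ∑ v ∈ X, φ u v = -∑ u ∈ X, ∑ v ∈ X, φ u v := by
      conv_lhs => rw [Finset.sum_comm]
      simp only [← Finset.sum_neg_distrib]
      exact Finset.sum_congr rfl fun u _ => Finset.sum_congr rfl fun v _ => h.antisymm v u
    omega
  have h1 : ∑ u ∈ X, ∑ v ∈ G.verts, φ u v = T.card - (X ∩ T).card := by
    rw [Finset.sum_congr rfl fun u hu => h.sum_eq u (hX hu), Finset.sum_sub_distrib,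
      Finset.sum_ite_eq', if_pos ha, Finset.sum_boole, Finset.filter_mem_eq_inter]
  have h2 : ∀ u, ∑ v ∈ G.verts, φ u v = ∑ v ∈ G.verts \ X, φ u v + ∑ v ∈ X, φ u v :=
    fun u => (Finset.sum_sdiff hX).symm
  simp only [h2, Finset.sum_add_distrib] at h1
  omega

theorem mem_verts_left {G : Multigraph V} {u v : V} (h : G.mult s(u, v) ≠ 0) : u ∈ G.verts :=
  G.supp _ h u (Sym2.mem_mk_left u v)

theorem mem_verts_right {G : Multigraph V} {u v : V} (h : G.mult s(u, v) ≠ 0) : v ∈ G.verts :=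
  G.supp _ h v (Sym2.mem_mk_right u v)

theorem IsFlow.mult_ne_zero {G : Multigraph V} {a : V} {T : Finset V} {φ : V → V → ℤ}
    (h : G.IsFlow a T φ) {u v : V} (huv : φ u v < G.mult s(u, v)) : G.mult s(u, v) ≠ 0 := by
  intro h0
  have := h.le_mult v u
  rw [h.antisymm, Sym2.eq_swap] at this
  omega

theorem forall_mem_verts_of_isChain {G : Multigraph V} {l : List V} {a : V} {r : V → V → Prop}
    (hr : ∀ u v, r u v → G.mult s(u, v) ≠ 0) (ha : a ∈ G.verts) (hl : l.IsChain r)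
    (hh : l.head? = some a) : ∀ v ∈ l, v ∈ G.verts := by
  induction l generalizing a with
  | nil => simp
  | cons b l ih =>
    simp at hh
    subst hh
    cases l with
    | nil => simpa
    | cons c l =>
      rw [List.isChain_cons_cons] at hl
      have := ih (mem_verts_right (hr _ _ hl.1)) hl.2 rfl
      simp_all

theorem exists_reachable_finset {G : Multigraph V} {a : V} (ha : a ∈ G.verts)
    (r : V → V → Prop) :
    ∃ X ⊆ G.verts, a ∈ X ∧ (∀ u ∈ X, Relation.ReflTransGen r a u) ∧
      ∀ u ∈ X, ∀ v ∈ G.verts \ X, ¬ r u v := by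
  refine ⟨G.verts.filter (Relation.ReflTransGen r a), Finset.filter_subset _ _,
    Finset.mem_filter.2 ⟨ha, .refl⟩, fun u hu => (Finset.mem_filter.1 hu).2, ?_⟩
  intro u hu v hv huv
  rw [Finset.mem_sdiff, Finset.mem_filter] at hv
  exact hv.2 ⟨hv.1, (Finset.mem_filter.1 hu).2.tail huv⟩

/-- Augmentation of a flow along a path of the residual graph. -/
theorem IsFlow.augment {G : Multigraph V} {a : V} {S T : Finset V} {φ : V → V → ℤ}
    (h : G.IsFlow a T φ) (ha : a ∈ G.verts) (hTS : T ⊆ S) (hlt : T.card < S.card)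
    (hcut : ∀ X ⊆ G.verts, a ∈ X → S.card ≤ G.cut X + (X ∩ S).card) :
    ∃ s ∈ S, s ∉ T ∧ ∃ ψ, G.IsFlow a (insert s T) ψ := by
  obtain ⟨X, hX, haX, hreach, hclosed⟩ :=
    exists_reachable_finset ha fun u v => φ u v < G.mult s(u, v)
  obtain ⟨s, hs, hsX⟩ : ∃ s ∈ X ∩ S, s ∉ T := by
    by_contra! hno
    have h1 := h.sum_leaving hX haX
    have h2 : ∑ u ∈ X, ∑ v ∈ G.verts \ X, φ u v = G.cut X := by
      rw [cut]
      push_cast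
      refine Finset.sum_congr rfl fun u hu => Finset.sum_congr rfl fun v hv => ?_
      exact le_antisymm (h.le_mult u v) (not_lt.1 (hclosed u hu v hv))
    have h3 : X ∩ S = X ∩ T := Finset.Subset.antisymm
      (fun s hs => Finset.mem_inter.2 ⟨(Finset.mem_inter.1 hs).1, hno s hs⟩)
      (Finset.inter_subset_inter_left hTS)
    have h4 := hcut X hX haX
    rw [h3] at h4
    omega
  rw [Finset.mem_inter] at hs
  refine ⟨s, hs.2, hsX, ?_⟩
  obtain ⟨l, hn, hc, hh, hl⟩ := exists_nodup_isChain (hreach s hs.1)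
  have hlv := forall_mem_verts_of_isChain (fun u v => h.mult_ne_zero) ha hc hh
  refine ⟨fun u v => φ u v + listFlow l u v, ?_, ?_, ?_⟩
  · intro u v
    have := h.antisymm u v
    simp only [listFlow]
    omega
  · intro u v
    have h1 := h.le_mult u v
    have h2 := (List.nodup_iff_count_le_one.1 (nodup_listArcs hn)) (u, v)
    simp only [listFlow]
    by_cases h3 : (u, v) ∈ listArcs l
    · have := rel_of_mem_listArcs hc h3
      simp only at this
      omega
    · have := List.count_eq_zero.2 h3
      omega
  · intro u hu
    rw [Finset.sum_add_distrib, h.sum_eq u hu, sum_listFlow hlv hh hl,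
      Finset.card_insert_of_notMem hsX]
    by_cases h1 : u = a <;> by_cases h2 : u = s <;> by_cases h3 : u ∈ T <;> simp_all

/-- Max-flow min-cut for flows from one vertex to a set of sinks of unit demand. -/
theorem exists_isFlow {G : Multigraph V} {a : V} {S : Finset V} (ha : a ∈ G.verts)
    (hcut : ∀ X ⊆ G.verts, a ∈ X → S.card ≤ G.cut X + (X ∩ S).card) :
    ∃ φ, G.IsFlow a S φ := by
  have key : ∀ k ≤ S.card, ∃ T ⊆ S, T.card = k ∧ ∃ φ, G.IsFlow a T φ := by
    intro k
    induction k with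
    | zero =>
      intro _
      exact ⟨∅, by simp, rfl, fun _ _ => 0, by simp, by simp, by simp⟩
    | succ k ih =>
      intro hk
      obtain ⟨T, hT, hcard, φ, hφ⟩ := ih (by omega)
      obtain ⟨s, hs, hsT, ψ, hψ⟩ := hφ.augment ha hT (by omega) hcut
      exact ⟨insert s T, Finset.insert_subset hs hT, by
        rw [Finset.card_insert_of_notMem hsT, hcard], ψ, hψ⟩
  obtain ⟨T, hT, hcard, hφ⟩ := key S.card le_rfl
  rwa [Finset.eq_of_subset_of_card_le hT hcard.ge] at hφ

/-- A path to a prescribed sink can be split off from a flow. -/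
theorem IsFlow.exists_path {G : Multigraph V} {a s : V} {T : Finset V} {φ : V → V → ℤ}
    (h : G.IsFlow a T φ) (hG : ∀ e, G.mult e ≤ 1) (ha : a ∈ G.verts) (hs : s ∈ T) :
    ∃ l ψ, G.IsPathBetween a s l ∧ G.IsFlow a (T.erase s) ψ ∧
      (∀ p ∈ listArcs l, 0 < φ p.1 p.2) ∧
      ∀ u v, 0 < ψ u v → 0 < φ u v ∧ s(u, v) ∉ listEdges l := by
  obtain ⟨X, hX, haX, hreach, hclosed⟩ := exists_reachable_finset ha fun u v => 0 < φ u v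
  have hsX : s ∈ X := by
    have h1 := h.sum_leaving hX haX
    have h2 : ∑ u ∈ X, ∑ v ∈ G.verts \ X, φ u v ≤ 0 :=
      Finset.sum_nonpos fun u hu => Finset.sum_nonpos fun v hv => not_lt.1 (hclosed u hu v hv)
    have h3 : X ∩ T = T :=
      Finset.eq_of_subset_of_card_le Finset.inter_subset_right (by omega)
    exact (Finset.mem_inter.1 (h3.symm ▸ hs)).1
  obtain ⟨l, hn, hc, hh, hl⟩ := exists_nodup_isChain (hreach s hsX)
  have hmult : ∀ u v, 0 < φ u v → G.mult s(u, v) ≠ 0 := fun u v huv h0 => by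
    have := h.le_mult u v
    omega
  have hlv := forall_mem_verts_of_isChain hmult ha hc hh
  have hpos : ∀ u v, (u, v) ∈ listArcs l → 0 < φ u v := fun u v huv => rel_of_mem_listArcs hc huv
  have hcount : ∀ u v, φ u v ≤ 0 → (listArcs l).count (u, v) = 0 := fun u v huv =>
    List.count_eq_zero.2 fun hmem => by have := hpos u v hmem; omega
  refine ⟨l, fun u v => φ u v - listFlow l u v, ⟨⟨?_, hn, hlv, ?_⟩, hh, hl⟩, ⟨?_, ?_, ?_⟩,
    fun p hp => hpos p.1 p.2 hp, ?_⟩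
  · rintro rfl
    simp at hh
  · refine List.IsChain.imp (fun u v huv => ⟨?_, hmult u v huv⟩) hc
    rintro rfl
    have := h.antisymm u u
    omega
  · intro u v
    have := h.antisymm u v
    simp only [listFlow]
    omega
  · intro u v
    have h1 := h.le_mult u v
    have h2 := (List.nodup_iff_count_le_one.1 (nodup_listArcs hn)) (v, u)
    have h3 := hcount v u
    have h4 := h.antisymm u v
    simp only [listFlow]
    omega
  · intro u hu
    rw [Finset.sum_sub_distrib, h.sum_eq u hu, sum_listFlow hlv hh hl,
      Finset.cast_card_erase_of_mem hs]
    by_cases h1 : u = a <;> by_cases h2 : u = s <;> by_cases h3 : u ∈ T <;> simp_all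
  · intro u v huv
    have h1 := h.le_mult u v
    have h2 := hcount u v
    have h3 := hcount v u
    have h4 := h.antisymm u v
    have h5 := hG s(u, v)
    simp only [listFlow] at huv
    have h6 := (List.nodup_iff_count_le_one.1 (nodup_listArcs hn)) (v, u)
    refine ⟨by omega, fun hmem => ?_⟩
    obtain ⟨⟨p, q⟩, hp, hpe⟩ := mem_listEdges.1 hmem
    have h7 := List.count_pos_iff.2 hp
    dsimp only at hpe
    rcases Sym2.eq_iff.1 hpe with ⟨rfl, rfl⟩ | ⟨rfl, rfl⟩
    · omega
    · have := hpos _ _ hp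
      omega

theorem card_triple {x y z : V} (hxy : x ≠ y) (hxz : x ≠ z) (hyz : y ≠ z) :
    ({x, y, z} : Finset V).card = 3 :=
  Finset.card_eq_three.2 ⟨x, y, z, hxy, hxz, hyz, rfl⟩

/-- The edge version of Menger's theorem for three sinks. -/
theorem threeConnFrom_of_cut {G : Multigraph V} {a x y z : V} (hxy : x ≠ y) (hxz : x ≠ z)
    (hyz : y ≠ z) (hG : ∀ e, G.mult e ≤ 1) (ha : a ∈ G.verts)
    (hcut : ∀ X ⊆ G.verts, a ∈ X → 3 ≤ G.cut X + (X ∩ {x, y, z}).card) :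
    G.ThreeConnFrom x y z a := by
  rw [← card_triple hxy hxz hyz] at hcut
  obtain ⟨φ, hφ⟩ := exists_isFlow ha hcut
  obtain ⟨l₁, φ₁, hl₁, hφ₁, -, hd₁⟩ := hφ.exists_path hG ha (s := x) (by simp)
  obtain ⟨l₂, φ₂, hl₂, hφ₂, hp₂, hd₂⟩ := hφ₁.exists_path hG ha (s := y) (by simp [hxy.symm])
  obtain ⟨l₃, φ₃, hl₃, -, hp₃, -⟩ :=
    hφ₂.exists_path hG ha (s := z) (by simp [hxz.symm, hyz.symm])
  refine ⟨l₁, l₂, l₃, hl₁, hl₂, hl₃, ?_, ?_, ?_⟩ <;> rw [List.disjoint_left] <;>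
    intro e he he' <;> obtain ⟨p, hp, rfl⟩ := mem_listEdges.1 he'
  · exact (hd₁ _ _ (hp₂ p hp)).2 he
  · exact (hd₁ _ _ (hd₂ _ _ (hp₃ p hp)).1).2 he
  · exact (hd₂ _ _ (hp₃ p hp)).2 he

theorem cut_eq_sum_ite {G : Multigraph V} {X : Finset V} (hX : X ⊆ G.verts) :
    G.cut X = ∑ u ∈ G.verts, ∑ v ∈ G.verts, if u ∈ X ∧ v ∉ X then G.mult s(u, v) else 0 := by
  rw [cut, ← Finset.sum_filter_add_sum_filter_not G.verts (· ∈ X),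
    Finset.filter_mem_eq_inter, Finset.inter_eq_right.2 hX]
  rw [Finset.sum_eq_zero (s := G.verts.filter (· ∉ X)), add_zero]
  · refine Finset.sum_congr rfl fun u hu => ?_
    rw [← Finset.sum_filter]
    simp only [hu, true_and, Finset.sdiff_eq_filter]
  · intro u hu
    simp [(Finset.mem_filter.1 hu).2]

theorem cut_inter_add_cut_union_le {G : Multigraph V} {X Y : Finset V} (hX : X ⊆ G.verts)
    (hY : Y ⊆ G.verts) : G.cut (X ∩ Y) + G.cut (X ∪ Y) ≤ G.cut X + G.cut Y := by
  rw [cut_eq_sum_ite hX, cut_eq_sum_ite hY, cut_eq_sum_ite (Finset.union_subset hX hY),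
    cut_eq_sum_ite (Finset.inter_subset_left.trans hX)]
  simp only [← Finset.sum_add_distrib]
  refine Finset.sum_le_sum fun u _ => Finset.sum_le_sum fun v _ => ?_
  by_cases h1 : u ∈ X <;> by_cases h2 : u ∈ Y <;> by_cases h3 : v ∈ X <;>
    by_cases h4 : v ∈ Y <;> simp [h1, h2, h3, h4]

theorem cut_compl {G : Multigraph V} {X : Finset V} (hX : X ⊆ G.verts) :
    G.cut (G.verts \ X) = G.cut X := by
  rw [cut, cut, Finset.sdiff_sdiff_eq_self hX, Finset.sum_comm]
  simp only [Sym2.eq_swap]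

theorem cut_sdiff_add_cut_sdiff_le {G : Multigraph V} {X Y : Finset V} (hX : X ⊆ G.verts)
    (hY : Y ⊆ G.verts) : G.cut (X \ Y) + G.cut (Y \ X) ≤ G.cut X + G.cut Y := by
  have h := cut_inter_add_cut_union_le hX (Finset.sdiff_subset (s := G.verts) (t := Y))
  have h1 : X ∩ (G.verts \ Y) = X \ Y := by
    ext v; simp only [Finset.mem_inter, Finset.mem_sdiff]; have := @hX v; tauto
  have h2 : X ∪ (G.verts \ Y) = G.verts \ (Y \ X) := by
    ext v; simp only [Finset.mem_union, Finset.mem_sdiff]; have := @hX v; tauto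
  rwa [h1, h2, cut_compl hY, cut_compl (Finset.sdiff_subset.trans hY)] at h

theorem cut_add_sum_inside {G : Multigraph V} {X : Finset V} (hX : X ⊆ G.verts) :
    G.cut X + ∑ u ∈ X, ∑ v ∈ X, G.mult s(u, v) = ∑ u ∈ X, ∑ v ∈ G.verts, G.mult s(u, v) := by
  rw [cut, ← Finset.sum_add_distrib]
  exact Finset.sum_congr rfl fun u _ => Finset.sum_sdiff hX

theorem cut_add_card_add_sum_inside {G : Multigraph V} {S X : Finset V} (hX : X ⊆ G.verts)
    (h : ∀ v ∈ G.verts, ∑ u ∈ G.verts, G.mult s(v, u) + (if v ∈ S then 1 else 0) = 3) :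
    G.cut X + (X ∩ S).card + ∑ u ∈ X, ∑ v ∈ X, G.mult s(u, v) = 3 * X.card := by
  have h1 := cut_add_sum_inside hX
  have h2 : ∑ u ∈ X, (∑ v ∈ G.verts, G.mult s(u, v) + if u ∈ S then 1 else 0) = 3 * X.card := by
    rw [Finset.sum_congr rfl fun u hu => h u (hX hu)]
    simp [mul_comm]
  rw [Finset.sum_add_distrib, Finset.sum_boole, Finset.filter_mem_eq_inter] at h2
  simp only [Nat.cast_id] at h2
  omega

/-- Loopless multigraphs in which the vertices of the three-element set `S` have degree `2`,
all other vertices have degree `3`, and adding a vertex joined to `S` gives a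
3-edge-connected graph. -/
structure Admissible (G : Multigraph V) (S : Finset V) : Prop where
  subset : S ⊆ G.verts
  card : S.card = 3
  noLoop : ∀ v, G.mult s(v, v) = 0
  sum_mult : ∀ v ∈ G.verts, ∑ u ∈ G.verts, G.mult s(v, u) + (if v ∈ S then 1 else 0) = 3
  le_cut : ∀ X ⊆ G.verts, X.Nonempty → 3 ≤ G.cut X + (X ∩ S).card

namespace Admissible

variable {G : Multigraph V} {S : Finset V}

theorem cut_add_eq (h : G.Admissible S) {X : Finset V} (hX : X ⊆ G.verts) :
    G.cut X + (X ∩ S).card + ∑ u ∈ X, ∑ v ∈ X, G.mult s(u, v) = 3 * X.card :=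
  cut_add_card_add_sum_inside hX h.sum_mult

theorem sum_pair (h : G.Admissible S) {u v : V} (huv : u ≠ v) :
    ∑ a ∈ ({u, v} : Finset V), ∑ b ∈ ({u, v} : Finset V), G.mult s(a, b) =
      2 * G.mult s(u, v) := by
  simp only [Finset.sum_pair huv, h.noLoop, Sym2.eq_swap (a := v) (b := u)]
  ring

theorem mult_le_one (h : G.Admissible S) (e : Sym2 V) : G.mult e ≤ 1 := by
  induction e with | _ u v
  by_cases huv : u = v
  · rw [huv, h.noLoop]
    omega
  by_contra! hm
  have hsub : ({u, v} : Finset V) ⊆ G.verts := by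
    intro w hw
    rcases Finset.mem_insert.1 hw with rfl | hw
    · exact mem_verts_left (v := v) (by omega)
    · rw [Finset.mem_singleton.1 hw]
      exact mem_verts_right (u := u) (by omega)
  have h1 := h.cut_add_eq hsub
  rw [h.sum_pair huv, Finset.card_pair huv] at h1
  have h2 := h.le_cut _ hsub (by simp)
  omega

/-- A set of vertices whose boundary is a nontrivial cut with three edges after adding a vertex
joined to `S`. -/
structure _root_.Multigraph.IsTight (G : Multigraph V) (S X : Finset V) : Prop where
  subset : X ⊆ G.verts
  two_le_card : 2 ≤ X.card
  ne_verts : X ≠ G.verts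
  cut_eq : G.cut X + (X ∩ S).card = 3

theorem card_ne_two (h : G.Admissible S) {X : Finset V} (hX : G.IsTight S X) : X.card ≠ 2 := by
  intro hcard
  have h1 := h.cut_add_eq hX.subset
  have h2 := hX.cut_eq
  obtain ⟨u, v, huv, rfl⟩ := Finset.card_eq_two.1 hcard
  rw [h.sum_pair huv] at h1
  omega

/-- No tight set crosses an edge inside a tight set of minimum cardinality. -/
theorem mem_of_minimal (h : G.Admissible S) {X : Finset V} (hX : G.IsTight S X)
    (hmin : ∀ Y, G.IsTight S Y → X.card ≤ Y.card) {a b : V} (ha : a ∈ X) (hb : b ∈ X)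
    {Y : Finset V} (hY : G.IsTight S Y) (haY : a ∈ Y) : b ∈ Y := by
  by_contra hbY
  have small : ∀ Z ⊂ X, G.cut Z + (Z ∩ S).card = 3 → Z.card ≤ 1 := by
    intro Z hZ hcut
    by_contra! hcard
    have := hmin Z ⟨hZ.1.trans hX.subset, hcard, fun hv => hZ.2 (hv ▸ hX.subset), hcut⟩
    exact absurd (Finset.card_lt_card hZ) (by omega)
  have hA : (X ∩ Y) ⊂ X :=
    Finset.ssubset_iff_subset_ne.2 ⟨Finset.inter_subset_left, fun heq => by
      rw [← heq] at hb; exact hbY (Finset.mem_inter.1 hb).2⟩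
  have hB : (X \ Y) ⊂ X :=
    Finset.ssubset_iff_subset_ne.2 ⟨Finset.sdiff_subset, fun heq => by
      rw [← heq] at ha; exact (Finset.mem_sdiff.1 ha).2 haY⟩
  have hC : (Y \ X).Nonempty := by
    rw [Finset.sdiff_nonempty]
    intro hsub
    have h1 : Y ⊂ X := Finset.ssubset_iff_subset_ne.2 ⟨hsub, fun heq => hbY (heq ▸ hb)⟩
    exact absurd (Finset.card_lt_card h1) (by have := hmin Y hY; omega)
  have h1 := cut_inter_add_cut_union_le hX.subset hY.subset
  have h2 := cut_sdiff_add_cut_sdiff_le hX.subset hY.subset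
  have h3 := h.le_cut _ (hA.1.trans hX.subset) ⟨a, Finset.mem_inter.2 ⟨ha, haY⟩⟩
  have h4 := h.le_cut _ (Finset.union_subset hX.subset hY.subset)
    ⟨a, Finset.mem_union_left _ ha⟩
  have h5 := h.le_cut _ (hB.1.trans hX.subset) ⟨b, Finset.mem_sdiff.2 ⟨hb, hbY⟩⟩
  have h6 := h.le_cut _ (Finset.sdiff_subset.trans hY.subset) hC
  have h7 : ((X ∩ Y) ∩ S).card + ((X ∪ Y) ∩ S).card = (X ∩ S).card + (Y ∩ S).card := by
    rw [Finset.inter_inter_distrib_right, Finset.union_inter_distrib_right, add_comm,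
      Finset.card_union_add_card_inter]
  have h8 : ((X \ Y) ∩ S).card ≤ (X ∩ S).card :=
    Finset.card_le_card (Finset.inter_subset_inter_right Finset.sdiff_subset)
  have h9 : ((Y \ X) ∩ S).card ≤ (Y ∩ S).card :=
    Finset.card_le_card (Finset.inter_subset_inter_right Finset.sdiff_subset)
  have h10 := hX.cut_eq
  have h11 := hY.cut_eq
  have h12 := small _ hA (by omega)
  have h13 := small _ hB (by omega)
  have h14 := Finset.card_inter_add_card_sdiff X Y
  have h15 := hX.two_le_card
  exact h.card_ne_two hX (by omega)

theorem exists_edge_of_isTight (h : G.Admissible S) {X : Finset V} (hX : G.IsTight S X) :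
    ∃ a ∈ X \ S, ∃ b ∈ X \ S, G.mult s(a, b) ≠ 0 := by
  by_contra! hno
  have hYV : X \ S ⊆ G.verts := Finset.sdiff_subset.trans hX.subset
  have hZV : X ∩ S ⊆ G.verts := Finset.inter_subset_left.trans hX.subset
  have h1 := h.cut_add_eq hYV
  rw [Finset.sum_eq_zero fun u hu => Finset.sum_eq_zero fun v hv => hno u hu v hv] at h1
  have h2 := h.cut_add_eq hZV
  have h3 := cut_sdiff_add_cut_sdiff_le hX.subset hZV
  have h4 : X \ (X ∩ S) = X \ S := Finset.sdiff_inter_self_left X S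
  have h5 : (X ∩ S) \ X = ∅ := Finset.sdiff_eq_empty_iff_subset.2 Finset.inter_subset_left
  have h6 : (X \ S) ∩ S = ∅ := Finset.sdiff_inter_self S X
  have h7 : (X ∩ S) ∩ S = X ∩ S := by simp
  have h8 : (G.verts \ X).Nonempty :=
    Finset.sdiff_nonempty.2 fun hsub => hX.ne_verts (hX.subset.antisymm hsub)
  have h9 := h.le_cut _ Finset.sdiff_subset h8
  have h10 : (G.verts \ X) ∩ S = S \ X := by
    ext v; simp only [Finset.mem_inter, Finset.mem_sdiff]; have := @h.subset v; tauto
  have h11 := Finset.card_inter_add_card_sdiff S X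
  have h12 := Finset.card_inter_add_card_sdiff X S
  have h13 := hX.cut_eq
  have h14 := hX.two_le_card
  have h15 := h.card_ne_two hX
  have h16 := h.card
  rw [cut_compl hX.subset, h10] at h9
  rw [Finset.inter_comm S X] at h11
  rw [h4, h5] at h3
  rw [h6, Finset.card_empty] at h1
  rw [h7] at h2
  omega

/-- If some edge avoids `S`, then some edge avoiding `S` is crossed by no tight set. -/
theorem exists_uncrossed_edge (h : G.Admissible S)
    (hE : ∃ a ∈ G.verts \ S, ∃ b ∈ G.verts \ S, G.mult s(a, b) ≠ 0) :
    ∃ a ∈ G.verts \ S, ∃ b ∈ G.verts \ S, G.mult s(a, b) ≠ 0 ∧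
      ∀ Y, G.IsTight S Y → (a ∈ Y ↔ b ∈ Y) := by
  by_cases hT : ∃ X, G.IsTight S X
  · obtain ⟨X, hX, hmin⟩ := exists_minimalFor_of_wellFoundedLT (G.IsTight S) Finset.card hT
    have hmin' : ∀ Y, G.IsTight S Y → X.card ≤ Y.card := fun Y hY =>
      (le_total X.card Y.card).elim id fun hle => hmin hY hle
    obtain ⟨a, ha, b, hb, hab⟩ := h.exists_edge_of_isTight hX
    have hsub := Finset.sdiff_subset_sdiff hX.subset (subset_refl S)
    have haX := (Finset.mem_sdiff.1 ha).1
    have hbX := (Finset.mem_sdiff.1 hb).1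
    exact ⟨a, hsub ha, b, hsub hb, hab, fun Y hY =>
      ⟨h.mem_of_minimal hX hmin' haX hbX hY, h.mem_of_minimal hX hmin' hbX haX hY⟩⟩
  · obtain ⟨a, ha, b, hb, hab⟩ := hE
    exact ⟨a, ha, b, hb, hab, fun Y hY => (hT ⟨Y, hY⟩).elim⟩

end Admissible

theorem count_nbrs (G : Multigraph V) (x u : V) : (G.nbrs x).count u = G.mult s(x, u) := by
  rw [nbrs, Multiset.count_bind]
  simp only [Multiset.count_replicate]
  change ∑ v ∈ G.verts, _ = _
  rw [Finset.sum_ite_eq']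
  split_ifs with hu
  · rfl
  · by_contra h
    exact hu (mem_verts_right (Ne.symm h))

theorem deg_eq_sum (G : Multigraph V) (x : V) : G.deg x = ∑ u ∈ G.verts, G.mult s(x, u) := by
  rw [deg, nbrs, Multiset.card_bind]
  simp only [Function.comp_def, Multiset.card_replicate]
  rfl

namespace Admissible

variable {G : Multigraph V} {S : Finset V}

theorem deg_eq_three (h : G.Admissible S) {a : V} (ha : a ∈ G.verts \ S) : G.deg a = 3 := by
  rw [Finset.mem_sdiff] at ha
  simpa [ha.2, deg_eq_sum] using h.sum_mult a ha.1

theorem exists_nbrs (h : G.Admissible S) {a b : V} (ha : a ∈ G.verts \ S)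
    (hab : G.mult s(a, b) ≠ 0) :
    ∃ z w, G.nbrs a = {b, z, w} ∧ z ≠ w ∧
      z ∈ G.verts \ {a, b} ∧ w ∈ G.verts \ {a, b} ∧
      ∀ u ∈ G.verts \ {a, b}, G.mult s(a, u) = (if u = z then 1 else 0) + if u = w then 1 else 0 := by
  have hb : b ∈ G.nbrs a := by
    rw [← Multiset.count_pos, count_nbrs]
    omega
  obtain ⟨s, hs⟩ := Multiset.exists_cons_of_mem hb
  have hcard : s.card = 2 := by
    have := h.deg_eq_three ha
    rw [deg, hs, Multiset.card_cons] at this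
    omega
  obtain ⟨z, w, rfl⟩ := Multiset.card_eq_two.1 hcard
  have hnbrs : G.nbrs a = {b, z, w} := hs
  have hcount : ∀ u, G.mult s(a, u) = Multiset.count u {b, z, w} := fun u => by
    rw [← hnbrs, count_nbrs]
  have hnodup : ({b, z, w} : Multiset V).Nodup := by
    rw [Multiset.nodup_iff_count_le_one]
    intro u
    rw [← hcount]
    exact h.mult_le_one _
  have hmem : ∀ u ∈ ({b, z, w} : Multiset V), u ∈ G.verts ∧ u ≠ a := by
    intro u hu
    rw [← Multiset.count_pos, ← hcount] at hu
    refine ⟨mem_verts_right hu.ne', ?_⟩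
    rintro rfl
    rw [h.noLoop] at hu
    omega
  have h1 := hmem z (by simp)
  have h2 := hmem w (by simp)
  simp at hnodup
  refine ⟨z, w, hnbrs, hnodup.2, by simp [h1, Ne.symm hnodup.1.1], by simp [h2, Ne.symm hnodup.1.2],
    fun u hu => ?_⟩
  simp at hu
  rw [hcount]
  simp [-Multiset.cons_zero, Multiset.insert_eq_cons,
    Multiset.count_cons, Multiset.count_singleton, hu.2]
  ring

end Admissible

theorem ite_mk_eq {u v z w : V} (hzw : z ≠ w) :
    (if s(u, v) = s(z, w) then 1 else 0 : ℕ) =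
      (if u = z then (if v = w then 1 else 0) else 0) +
        if u = w then (if v = z then 1 else 0) else 0 := by
  by_cases h1 : u = z <;> by_cases h2 : v = w <;> by_cases h3 : u = w <;>
    by_cases h4 : v = z <;> simp_all

theorem sum_ite_mk_eq {A : Finset V} {u z w : V} (hzw : z ≠ w) (hz : z ∈ A) (hw : w ∈ A) :
    ∑ v ∈ A, (if s(u, v) = s(z, w) then 1 else 0 : ℕ) =
      (if u = z then 1 else 0) + if u = w then 1 else 0 := by
  simp only [ite_mk_eq hzw, Finset.sum_add_distrib, Finset.sum_ite_irrel, Finset.sum_ite_eq', hz, hw,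
    if_true, Finset.sum_const_zero]

theorem sum_sum_ite_mk_eq {A X : Finset V} {z w : V} (hzw : z ≠ w) (hz : z ∈ A) (hw : w ∈ A) :
    ∑ u ∈ A, ∑ v ∈ A, (if u ∈ X ∧ v ∉ X then (if s(u, v) = s(z, w) then 1 else 0) else 0 : ℕ) =
      (if z ∈ X ∧ w ∉ X then 1 else 0) + if w ∈ X ∧ z ∉ X then 1 else 0 := by
  have key : ∀ u v, (if u ∈ X ∧ v ∉ X then (if s(u, v) = s(z, w) then 1 else 0) else 0 : ℕ) =
      (if u = z then (if v = w then (if z ∈ X ∧ w ∉ X then 1 else 0) else 0) else 0) +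
        if u = w then (if v = z then (if w ∈ X ∧ z ∉ X then 1 else 0) else 0) else 0 := by
    intro u v
    rw [ite_mk_eq hzw]
    by_cases h1 : u = z <;> by_cases h2 : v = w <;> by_cases h3 : u = w <;>
      by_cases h4 : v = z <;> simp_all
  simp only [key, Finset.sum_add_distrib, Finset.sum_ite_irrel, Finset.sum_ite_eq', hz, hw,
    if_true, Finset.sum_const_zero]

/-- The number of edges between a vertex `a` and the other side of a cut is computed from the
two neighbours of `a`; here `a` is placed on the side of `z`. -/
theorem sum_ite_nbr {A X : Finset V} {f : V → ℕ} {z w : V} (hw : w ∈ A)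
    (hf : ∀ u ∈ A, f u = (if u = z then 1 else 0) + if u = w then 1 else 0) :
    (∑ v ∈ A, if z ∈ X ∧ v ∉ X then f v else 0) + (∑ u ∈ A, if u ∈ X ∧ z ∉ X then f u else 0) =
      (if z ∈ X ∧ w ∉ X then 1 else 0) + if w ∈ X ∧ z ∉ X then 1 else 0 := by
  have h1 : ∀ v ∈ A, (if z ∈ X ∧ v ∉ X then f v else 0) + (if v ∈ X ∧ z ∉ X then f v else 0) =
      if v = w then ((if z ∈ X ∧ w ∉ X then 1 else 0) + if w ∈ X ∧ z ∉ X then 1 else 0) else 0 := by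
    intro v hv
    rw [hf v hv]
    by_cases h1 : v = z <;> by_cases h2 : v = w <;> by_cases h3 : z ∈ X <;>
      by_cases h4 : w ∈ X <;> simp_all
  rw [← Finset.sum_add_distrib, Finset.sum_congr rfl h1, Finset.sum_ite_eq', if_pos hw]

/-- An `H`-reduction by an edge that avoids `S` and is crossed by no tight set preserves
admissibility. -/
theorem Admissible.of_reduction {G G' : Multigraph V} {S : Finset V} (h : G.Admissible S)
    {a b z w t r : V} (ha : a ∈ G.verts \ S) (hb : b ∈ G.verts \ S) (hab : a ≠ b)
    (hm : G.mult s(a, b) = 1) (hT : ∀ Y, G.IsTight S Y → (a ∈ Y ↔ b ∈ Y))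
    (hzw : z ≠ w) (hz : z ∈ G.verts \ {a, b}) (hw : w ∈ G.verts \ {a, b})
    (hna : ∀ u ∈ G.verts \ {a, b},
      G.mult s(a, u) = (if u = z then 1 else 0) + if u = w then 1 else 0)
    (htr : t ≠ r) (ht : t ∈ G.verts \ {a, b}) (hr : r ∈ G.verts \ {a, b})
    (hnb : ∀ u ∈ G.verts \ {a, b},
      G.mult s(b, u) = (if u = t then 1 else 0) + if u = r then 1 else 0)
    (hverts : G'.verts = G.verts \ {a, b})
    (hmult : ∀ e, G'.mult e = (if a ∈ e ∨ b ∈ e then 0 else G.mult e)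
      + (if e = s(z, w) then 1 else 0) + (if e = s(t, r) then 1 else 0)) :
    G'.Admissible S := by
  rw [Finset.mem_sdiff] at ha hb
  set W := G.verts \ {a, b} with hW
  have haW : a ∉ W := by simp [hW]
  have hbW : b ∉ W := by simp [hW]
  have hV : G.verts = insert a (insert b W) := by
    ext v
    simp only [hW, Finset.mem_insert, Finset.mem_sdiff, Finset.mem_singleton]
    constructor
    · tauto
    · rintro (rfl | rfl | hv)
      exacts [ha.1, hb.1, hv.1]
  have haW' : a ∉ insert b W := by simp [hab, haW]
  have hmW : ∀ u ∈ W, ∀ v ∈ W, G'.mult s(u, v) = G.mult s(u, v)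
      + (if s(u, v) = s(z, w) then 1 else 0) + (if s(u, v) = s(t, r) then 1 else 0) := by
    intro u hu v hv
    rw [hmult, if_neg]
    simp only [Sym2.mem_iff, not_or]
    refine ⟨⟨?_, ?_⟩, ?_, ?_⟩ <;> rintro rfl <;> contradiction
  have hSW : S ⊆ W := by
    intro v hv
    rw [hW, Finset.mem_sdiff]
    refine ⟨h.subset hv, ?_⟩
    simp only [Finset.mem_insert, Finset.mem_singleton, not_or]
    exact ⟨fun h => ha.2 (h ▸ hv), fun h => hb.2 (h ▸ hv)⟩
  refine ⟨hverts ▸ hSW, h.card, ?_, ?_, ?_⟩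
  · intro v
    have h1 : s(v, v) ≠ s(z, w) := fun h => hzw (by
      rcases Sym2.eq_iff.1 h with ⟨h1, h2⟩ | ⟨h1, h2⟩ <;> rw [← h1, ← h2])
    have h2 : s(v, v) ≠ s(t, r) := fun h => htr (by
      rcases Sym2.eq_iff.1 h with ⟨h1, h2⟩ | ⟨h1, h2⟩ <;> rw [← h1, ← h2])
    rw [hmult, if_neg h1, if_neg h2, h.noLoop, ite_self]
  · intro v hv
    rw [hverts] at hv ⊢
    have h1 := h.sum_mult v (Finset.mem_sdiff.1 hv).1
    rw [hV, Finset.sum_insert haW', Finset.sum_insert hbW, Sym2.eq_swap, hna v hv,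
      Sym2.eq_swap, hnb v hv] at h1
    rw [Finset.sum_congr rfl fun u hu => hmW v hv u hu, Finset.sum_add_distrib,
      Finset.sum_add_distrib, sum_ite_mk_eq hzw hz hw, sum_ite_mk_eq htr ht hr]
    omega
  · intro X hX hne
    rw [hverts] at hX
    by_contra! hlt
    set Y : Finset V := X ∪ ({a, b} : Finset V).filter
      fun v => (v = a ∧ z ∈ X) ∨ (v = b ∧ t ∈ X) with hY
    have haX : a ∉ X := fun h => haW (hX h)
    have hbX : b ∉ X := fun h => hbW (hX h)
    have haY : a ∈ Y ↔ z ∈ X := by simp [hY, haX, hab]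
    have hbY : b ∈ Y ↔ t ∈ X := by simp [hY, hbX, hab.symm]
    have hWY : ∀ v ∈ W, (v ∈ Y ↔ v ∈ X) := by
      intro v hv
      have h1 : v ≠ a := fun h => haW (h ▸ hv)
      have h2 : v ≠ b := fun h => hbW (h ▸ hv)
      simp [hY, h1, h2]
    have hYV : Y ⊆ G.verts := by
      refine Finset.union_subset (hX.trans Finset.sdiff_subset)
        ((Finset.filter_subset _ _).trans ?_)
      simp [Finset.insert_subset_iff, ha.1, hb.1]
    have hYS : Y ∩ S = X ∩ S := by
      ext v
      simp only [Finset.mem_inter]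
      exact and_congr_left fun hv => hWY v (hSW hv)
    have hcut' : G'.cut X = (∑ u ∈ W, ∑ v ∈ W, if u ∈ X ∧ v ∉ X then G.mult s(u, v) else 0)
        + ((if z ∈ X ∧ w ∉ X then 1 else 0) + if w ∈ X ∧ z ∉ X then 1 else 0)
        + ((if t ∈ X ∧ r ∉ X then 1 else 0) + if r ∈ X ∧ t ∉ X then 1 else 0) := by
      rw [cut_eq_sum_ite (hverts ▸ hX), hverts, ← sum_sum_ite_mk_eq hzw hz hw,
        ← sum_sum_ite_mk_eq htr ht hr]
      simp only [← Finset.sum_add_distrib]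
      refine Finset.sum_congr rfl fun u hu => Finset.sum_congr rfl fun v hv => ?_
      rw [hmW u hu v hv]
      split_ifs <;> rfl
    have hcut : G.cut Y = (∑ u ∈ W, ∑ v ∈ W, if u ∈ X ∧ v ∉ X then G.mult s(u, v) else 0)
        + ((∑ v ∈ W, if z ∈ X ∧ v ∉ X then G.mult s(a, v) else 0) +
          ∑ u ∈ W, if u ∈ X ∧ z ∉ X then G.mult s(a, u) else 0)
        + ((∑ v ∈ W, if t ∈ X ∧ v ∉ X then G.mult s(b, v) else 0) +
          ∑ u ∈ W, if u ∈ X ∧ t ∉ X then G.mult s(b, u) else 0)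
        + if (a ∈ Y ↔ b ∈ Y) then 0 else 1 := by
      have e1 : ∀ (p : Prop) [Decidable p] (c : V), (∑ v ∈ W, if p ∧ v ∉ Y then G.mult s(c, v) else 0) =
          ∑ v ∈ W, if p ∧ v ∉ X then G.mult s(c, v) else 0 := fun p _ c =>
        Finset.sum_congr rfl fun v hv => by simp only [hWY v hv]
      have e2 : ∀ (p : Prop) [Decidable p] (c : V), (∑ v ∈ W, if v ∈ Y ∧ p then G.mult s(v, c) else 0) =
          ∑ v ∈ W, if v ∈ X ∧ p then G.mult s(c, v) else 0 := fun p _ c =>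
        Finset.sum_congr rfl fun v hv => by
          simp only [hWY v hv, Sym2.eq_swap (a := v) (b := c)]
      have e3 : (∑ u ∈ W, ∑ v ∈ W, if u ∈ Y ∧ v ∉ X then G.mult s(u, v) else 0) =
          ∑ u ∈ W, ∑ v ∈ W, if u ∈ X ∧ v ∉ X then G.mult s(u, v) else 0 :=
        Finset.sum_congr rfl fun u hu => by simp only [hWY u hu]
      rw [cut_eq_sum_ite hYV, hV]
      simp only [Finset.sum_insert haW', Finset.sum_insert hbW, Finset.sum_add_distrib, e1, e2, e3,
        h.noLoop, Sym2.eq_swap (a := b) (b := a), hm, haY, hbY]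
      by_cases h1 : z ∈ X <;> by_cases h2 : t ∈ X <;> simp [h1, h2] <;> ring
    rw [sum_ite_nbr hw hna, sum_ite_nbr hr hnb] at hcut
    have hle := h.le_cut Y hYV (hne.mono Finset.subset_union_left)
    rw [hYS] at hle
    have hiff : ¬(a ∈ Y ↔ b ∈ Y) := by
      intro hiff
      rw [if_pos hiff] at hcut
      omega
    rw [if_neg hiff] at hcut
    refine hiff (hT Y ⟨hYV, ?_, ?_, by rw [hYS]; omega⟩)
    · obtain ⟨x, hx⟩ := hne
      have hxY : x ∈ Y := Finset.mem_union_left _ hx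
      refine Finset.one_lt_card.2 ?_
      by_cases haY' : a ∈ Y
      · exact ⟨x, hxY, a, haY', fun h => haX (h ▸ hx)⟩
      · exact ⟨x, hxY, b, by tauto, fun h => hbX (h ▸ hx)⟩
    · intro heq
      rw [heq] at hiff
      tauto

/-- Inside an admissible graph every vertex outside `S` is 3-connected to `S`. -/
theorem Admissible.threeConnTo {G : Multigraph V} {x y z : V} (h : G.Admissible {x, y, z})
    (hxy : x ≠ y) (hxz : x ≠ z) (hyz : y ≠ z) : G.ThreeConnTo x y z := fun a ha _ _ _ =>
  threeConnFrom_of_cut hxy hxz hyz h.mult_le_one ha fun X hX haX => h.le_cut X hX ⟨a, haX⟩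

/-- If some edge avoids `S`, then there is an `H`-reduction which preserves admissibility. -/
theorem Admissible.exists_reduction {G : Multigraph V} {S : Finset V} (h : G.Admissible S)
    (hE : ∃ a ∈ G.verts \ S, ∃ b ∈ G.verts \ S, G.mult s(a, b) ≠ 0) :
    ∃ a ∈ G.verts \ S, ∃ b ∈ G.verts \ S, ∃ G' : Multigraph V,
      G.IsHReductionBy a b G' ∧ G'.Admissible S ∧ G'.verts.card < G.verts.card := by
  obtain ⟨a, ha, b, hb, hab, hT⟩ := h.exists_uncrossed_edge hE
  have hm : G.mult s(a, b) = 1 := by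
    have := h.mult_le_one s(a, b)
    omega
  have hne : a ≠ b := by
    rintro rfl
    exact hab (h.noLoop a)
  have haV := (Finset.mem_sdiff.1 ha).1
  have hbV := (Finset.mem_sdiff.1 hb).1
  obtain ⟨z, w, hnA, hzw, hz, hw, hna⟩ := h.exists_nbrs ha hab
  obtain ⟨t, r, hnB, htr, ht, hr, hnb⟩ := h.exists_nbrs hb (Sym2.eq_swap ▸ hab)
  rw [Finset.pair_comm] at ht hr hnb
  let G' : Multigraph V :=
    { verts := G.verts \ {a, b}
      mult := fun e => (if a ∈ e ∨ b ∈ e then 0 else G.mult e)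
        + (if e = s(z, w) then 1 else 0) + (if e = s(t, r) then 1 else 0)
      supp := by
        intro e he v hv
        by_cases h1 : e = s(z, w)
        · rw [h1, Sym2.mem_iff] at hv
          rcases hv with rfl | rfl <;> assumption
        by_cases h2 : e = s(t, r)
        · rw [h2, Sym2.mem_iff] at hv
          rcases hv with rfl | rfl <;> assumption
        simp only [h1, h2, if_false, add_zero, ne_eq, ite_eq_left_iff, Classical.not_imp,
          not_or] at he
        rw [Finset.mem_sdiff, Finset.mem_insert, Finset.mem_singleton, not_or]
        exact ⟨G.supp e he.2 v hv, fun h => he.1.1 (h ▸ hv), fun h => he.1.2 (h ▸ hv)⟩ }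
  refine ⟨a, ha, b, hb, G', ⟨⟨haV, hbV, hne, hm, (h.deg_eq_three ha).ge, (h.deg_eq_three hb).ge⟩,
    Or.inl ⟨h.deg_eq_three ha, h.deg_eq_three hb, z, w, t, r, hnA, hnB, fun v => ?_, fun e => rfl⟩⟩,
    h.of_reduction ha hb hne hm hT hzw hz hw hna htr ht hr hnb rfl fun e => rfl, ?_⟩
  · simp [G', Finset.mem_sdiff]
  · exact Finset.card_lt_card (Finset.ssubset_iff_subset_ne.2 ⟨Finset.sdiff_subset, fun heq =>
      (Finset.mem_sdiff.1 ((Finset.ext_iff.1 heq a).2 haV)).2 (by simp)⟩)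

theorem exists_arc_leaving {l : List V} {X : Finset V} {a s : V} (ha : l.head? = some a)
    (hs : l.getLast? = some s) (haX : a ∈ X) (hsX : s ∉ X) :
    ∃ p ∈ listArcs l, p.1 ∈ X ∧ p.2 ∉ X := by
  induction l generalizing a with
  | nil => simp at ha
  | cons b l ih =>
    simp at ha
    subst ha
    cases l with
    | nil =>
      simp at hs
      exact (hsX (hs ▸ haX)).elim
    | cons c l =>
      by_cases hc : c ∈ X
      · obtain ⟨p, hp, h⟩ := ih rfl (by simpa using hs) hc
        exact ⟨p, by rw [listArcs_cons_cons]; exact List.mem_cons_of_mem _ hp, h⟩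
      · exact ⟨(b, c), by simp [listArcs_cons_cons], haX, hc⟩

/-- Edge-disjoint paths leaving a set of vertices use distinct edges of its boundary. -/
theorem card_sdiff_le_cut {G : Multigraph V} {S X : Finset V} {a : V} (haX : a ∈ X)
    (l : V → List V) (hl : ∀ s ∈ S, G.IsPathBetween a s (l s))
    (hdisj : ∀ s ∈ S, ∀ t ∈ S, s ≠ t → (listEdges (l s)).Disjoint (listEdges (l t))) :
    (S \ X).card ≤ G.cut X := by
  have harc : ∀ s ∈ S \ X, ∃ p ∈ listArcs (l s), p.1 ∈ X ∧ p.2 ∉ X := fun s hs =>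
    have hs' := Finset.mem_sdiff.1 hs
    exists_arc_leaving (hl s hs'.1).2.1 (hl s hs'.1).2.2 haX hs'.2
  choose! p hp hpX hpX' using harc
  have hadj : ∀ s ∈ S \ X, G.Adj (p s).1 (p s).2 := fun s hs =>
    rel_of_mem_listArcs (hl s (Finset.mem_sdiff.1 hs).1).1.2.2.2 (hp s hs)
  have hinj : Set.InjOn p (S \ X : Finset V) := by
    intro s hs t ht hst
    by_contra hne
    have hd := hdisj s (Finset.mem_sdiff.1 hs).1 t (Finset.mem_sdiff.1 ht).1 hne
    exact hd (mem_listEdges.2 ⟨p s, hp s hs, rfl⟩) (mem_listEdges.2 ⟨p t, hp t ht, by rw [hst]⟩)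
  have hmaps : Set.MapsTo p (S \ X : Finset V)
      ((X ×ˢ (G.verts \ X)).filter fun q => 1 ≤ G.mult s(q.1, q.2) : Finset (V × V)) := by
    intro s hs
    have h := (hadj s hs).2
    simp only [Finset.coe_filter, Finset.mem_product, Finset.mem_sdiff, Set.mem_ofPred_eq]
    exact ⟨⟨hpX s hs, mem_verts_right h, hpX' s hs⟩, Nat.one_le_iff_ne_zero.2 h⟩
  refine (Finset.card_le_card_of_injOn p hmaps hinj).trans ?_
  rw [cut, ← Finset.sum_product', Finset.card_eq_sum_ones]
  exact (Finset.sum_le_sum fun q hq => (Finset.mem_filter.1 hq).2).trans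
    (Finset.sum_le_sum_of_subset (Finset.filter_subset _ _))

theorem ThreeConnFrom.card_sdiff_le_cut {G : Multigraph V} {x y z a : V} {X : Finset V}
    (hxy : x ≠ y) (hxz : x ≠ z) (hyz : y ≠ z) (h : G.ThreeConnFrom x y z a) (haX : a ∈ X) :
    (({x, y, z} : Finset V) \ X).card ≤ G.cut X := by
  obtain ⟨l₁, l₂, l₃, h₁, h₂, h₃, h₁₂, h₁₃, h₂₃⟩ := h
  refine Multigraph.card_sdiff_le_cut haX
    (fun s => if s = x then l₁ else if s = y then l₂ else l₃) ?_ ?_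
  · simp [hxy.symm, hxz.symm, hyz.symm, h₁, h₂, h₃]
  · simp [hxy, hxz, hyz, hxy.symm, hxz.symm, hyz.symm, h₁₂, h₁₃, h₂₃, h₁₂.symm, h₁₃.symm, h₂₃.symm]

/-- A simple graph which is 3-connected to three vertices of degree `2` and whose other vertices
have degree `3` is admissible. -/
theorem admissible_of_threeConnTo {G : Multigraph V} {x y z : V}
    (hxy : x ≠ y) (hxz : x ≠ z) (hyz : y ≠ z)
    (hx : x ∈ G.verts) (hy : y ∈ G.verts) (hz : z ∈ G.verts)
    (hsimple : G.IsSimple) (h3c : G.ThreeConnTo x y z)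
    (hdeg3 : ∀ v ∈ G.verts, v ≠ x → v ≠ y → v ≠ z → G.deg v = 3)
    (hdx : G.deg x = 2) (hdy : G.deg y = 2) (hdz : G.deg z = 2) :
    G.Admissible {x, y, z} := by
  have hcard := card_triple hxy hxz hyz
  have hsum : ∀ v ∈ G.verts,
      ∑ u ∈ G.verts, G.mult s(v, u) + (if v ∈ ({x, y, z} : Finset V) then 1 else 0) = 3 := by
    intro v hv
    rw [← deg_eq_sum]
    by_cases h1 : v = x
    · simp [h1, hdx]
    by_cases h2 : v = y
    · simp [h2, hdy]
    by_cases h3 : v = z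
    · simp [h3, hdz]
    simp [h1, h2, h3, hdeg3 v hv]
  refine ⟨by simp [Finset.insert_subset_iff, hx, hy, hz], hcard, hsimple.2, hsum, ?_⟩
  intro X hX hne
  by_cases hXS : X ⊆ {x, y, z}
  · have h1 := cut_add_card_add_sum_inside hX hsum
    have h2 : ∑ u ∈ X, ∑ v ∈ X, G.mult s(u, v) ≤ X.card * (X.card - 1) := by
      refine Finset.sum_le_card_nsmul _ _ _ fun u hu => ?_
      rw [← Finset.add_sum_erase X _ hu, hsimple.2 u, zero_add, ← Finset.card_erase_of_mem hu]
      simpa using Finset.sum_le_card_nsmul (X.erase u) _ 1 fun v _ => hsimple.1 s(u, v)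
    have h3 := Finset.card_le_card hXS
    have h4 := hne.card_pos
    rw [hcard] at h3
    interval_cases X.card <;> omega
  · obtain ⟨a, haX, haS⟩ := Finset.not_subset.1 hXS
    simp only [Finset.mem_insert, Finset.mem_singleton, not_or] at haS
    have h1 := (h3c a (hX haX) haS.1 haS.2.1 haS.2.2).card_sdiff_le_cut hxy hxz hyz haX
    have h2 := Finset.card_inter_add_card_sdiff {x, y, z} X
    rw [Finset.inter_comm] at h2
    omega

/-- An admissible graph reduces to an admissible graph in which every edge meets `S`. -/
theorem Admissible.exists_reduction_sequence {G : Multigraph V} {S : Finset V}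
    (h : G.Admissible S) :
    ∃ (k : ℕ) (Gs : ℕ → Multigraph V), Gs 0 = G ∧
      (∀ i < k, ∃ a ∈ (Gs i).verts \ S, ∃ b ∈ (Gs i).verts \ S,
        (Gs i).IsHReductionBy a b (Gs (i + 1)) ∧ (Gs (i + 1)).Admissible S) ∧
      (Gs k).Admissible S ∧
      ∀ a ∈ (Gs k).verts \ S, ∀ b ∈ (Gs k).verts \ S, (Gs k).mult s(a, b) = 0 := by
  induction hn : G.verts.card using Nat.strong_induction_on generalizing G with
  | _ n ih =>
    by_cases hE : ∃ a ∈ G.verts \ S, ∃ b ∈ G.verts \ S, G.mult s(a, b) ≠ 0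
    · obtain ⟨a, ha, b, hb, G', hred, hG', hlt⟩ := h.exists_reduction hE
      obtain ⟨k, Gs, h0, hstep, hend⟩ := ih _ (hn ▸ hlt) hG' rfl
      refine ⟨k + 1, fun i => Nat.casesOn i G Gs, rfl, ?_, hend⟩
      rintro (_ | i) hi
      · refine ⟨a, ha, b, hb, ?_⟩
        change G.IsHReductionBy a b (Gs 0) ∧ (Gs 0).Admissible S
        rw [h0]
        exact ⟨hred, hG'⟩
      · exact hstep i (by omega)
    · push Not at hE
      exact ⟨0, fun _ => G, rfl, by simp, h, hE⟩

namespace Admissible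

variable {G : Multigraph V} {x y z : V}

theorem sum_triple (h : G.Admissible {x, y, z}) (hxy : x ≠ y) (hxz : x ≠ z) (hyz : y ≠ z) :
    ∑ a ∈ ({x, y, z} : Finset V), ∑ b ∈ ({x, y, z} : Finset V), G.mult s(a, b) =
      2 * (G.mult s(x, y) + G.mult s(y, z) + G.mult s(x, z)) := by
  have hx : x ∉ ({y, z} : Finset V) := by simp [hxy, hxz]
  simp only [Finset.sum_insert hx, Finset.sum_pair hyz, h.noLoop, Sym2.eq_swap (a := y) (b := x),
    Sym2.eq_swap (a := z) (b := x), Sym2.eq_swap (a := z) (b := y)]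
  ring

theorem sum_nbrs (h : G.Admissible {x, y, z}) (hxy : x ≠ y) (hxz : x ≠ z) (hyz : y ≠ z)
    (hE : ∀ a ∈ G.verts \ {x, y, z}, ∀ b ∈ G.verts \ {x, y, z}, G.mult s(a, b) = 0)
    {v : V} (hv : v ∈ G.verts \ {x, y, z}) :
    G.mult s(x, v) = 1 ∧ G.mult s(y, v) = 1 ∧ G.mult s(z, v) = 1 := by
  have h1 := h.sum_mult v (Finset.mem_sdiff.1 hv).1
  have hx : x ∉ ({y, z} : Finset V) := by simp [hxy, hxz]
  rw [if_neg (Finset.mem_sdiff.1 hv).2, ← Finset.sum_sdiff h.subset,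
    Finset.sum_eq_zero fun u hu => hE v hv u hu, Finset.sum_insert hx, Finset.sum_pair hyz,
    Sym2.eq_swap (a := v), Sym2.eq_swap (a := v), Sym2.eq_swap (a := v)] at h1
  have h2 := h.mult_le_one s(x, v)
  have h3 := h.mult_le_one s(y, v)
  have h4 := h.mult_le_one s(z, v)
  omega

/-- An admissible graph in which every edge meets `S` is a triangle or a `K_{2,3}`. -/
theorem eq_triangle_or_bipartite (h : G.Admissible {x, y, z})
    (hxy : x ≠ y) (hxz : x ≠ z) (hyz : y ≠ z)
    (hE : ∀ a ∈ G.verts \ {x, y, z}, ∀ b ∈ G.verts \ {x, y, z}, G.mult s(a, b) = 0) :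
    ((∀ v : V, v ∈ G.verts ↔ v = x ∨ v = y ∨ v = z) ∧
        (∀ e : Sym2 V, G.mult e =
          if e = s(x, y) ∨ e = s(y, z) ∨ e = s(x, z) then 1 else 0)) ∨
      (∃ v v' : V, v ≠ v' ∧
        v ≠ x ∧ v ≠ y ∧ v ≠ z ∧ v' ≠ x ∧ v' ≠ y ∧ v' ≠ z ∧
        (∀ w : V, w ∈ G.verts ↔ w = x ∨ w = y ∨ w = z ∨ w = v ∨ w = v') ∧
        (∀ e : Sym2 V, G.mult e =
          if e = s(x, v) ∨ e = s(x, v') ∨ e = s(y, v) ∨ e = s(y, v') ∨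
              e = s(z, v) ∨ e = s(z, v') then 1 else 0)) := by
  have h1 := h.cut_add_eq (Finset.sdiff_subset (s := G.verts) (t := {x, y, z}))
  have h2 := h.cut_add_eq h.subset
  rw [Finset.sum_eq_zero fun u hu => Finset.sum_eq_zero fun v hv => hE u hu v hv,
    Finset.sdiff_inter_self, cut_compl h.subset, Finset.card_empty] at h1
  rw [h.sum_triple hxy hxz hyz, Finset.inter_self, h.card] at h2
  have hmxy := h.mult_le_one s(x, y)
  have hmyz := h.mult_le_one s(y, z)
  have hmxz := h.mult_le_one s(x, z)
  have hverts : ∀ v, v ∈ G.verts ↔ v ∈ G.verts \ {x, y, z} ∨ v = x ∨ v = y ∨ v = z := by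
    intro v
    have h3 := @h.subset v
    simp only [Finset.mem_sdiff, Finset.mem_insert, Finset.mem_singleton] at h3 ⊢
    tauto
  obtain hY | hY : (G.verts \ {x, y, z}).card = 0 ∨ (G.verts \ {x, y, z}).card = 2 := by omega
  · left
    have hverts' : ∀ v, v ∈ G.verts ↔ v = x ∨ v = y ∨ v = z := by
      intro v
      rw [hverts, Finset.card_eq_zero.1 hY]
      simp
    refine ⟨hverts', fun e => ?_⟩
    split_ifs with he
    · rcases he with rfl | rfl | rfl <;> omega
    · by_contra hne
      induction e with | _ u v
      have hu := (hverts' u).1 (mem_verts_left hne)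
      have hv := (hverts' v).1 (mem_verts_right hne)
      have huv : u ≠ v := fun huv => hne (huv ▸ h.noLoop u)
      refine he ?_
      clear hverts hverts' hE h1 h2 he hne
      rcases hu with rfl | rfl | rfl <;> rcases hv with rfl | rfl | rfl <;>
        first | exact absurd rfl huv | simp
  · right
    obtain ⟨v, v', hvv, hY'⟩ := Finset.card_eq_two.1 hY
    have hv : v ∈ G.verts \ {x, y, z} := by simp [hY']
    have hv' : v' ∈ G.verts \ {x, y, z} := by simp [hY']
    have hvS := (Finset.mem_sdiff.1 hv).2
    have hvS' := (Finset.mem_sdiff.1 hv').2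
    simp only [Finset.mem_insert, Finset.mem_singleton, not_or] at hvS hvS'
    obtain ⟨hvx, hvy, hvz⟩ := h.sum_nbrs hxy hxz hyz hE hv
    obtain ⟨hvx', hvy', hvz'⟩ := h.sum_nbrs hxy hxz hyz hE hv'
    have hvv0 := hE v hv v' hv'
    have hverts' : ∀ w, w ∈ G.verts ↔ w = x ∨ w = y ∨ w = z ∨ w = v ∨ w = v' := by
      intro w
      rw [hverts, hY', Finset.mem_insert, Finset.mem_singleton]
      tauto
    have hxy0 : G.mult s(x, y) = 0 := by omega
    have hyz0 : G.mult s(y, z) = 0 := by omega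
    have hxz0 : G.mult s(x, z) = 0 := by omega
    refine ⟨v, v', hvv, hvS.1, hvS.2.1, hvS.2.2, hvS'.1, hvS'.2.1, hvS'.2.2, hverts', fun e => ?_⟩
    split_ifs with he
    · rcases he with rfl | rfl | rfl | rfl | rfl | rfl <;> assumption
    · by_contra hne
      induction e with | _ p q
      have hp := (hverts' p).1 (mem_verts_left hne)
      have hq := (hverts' q).1 (mem_verts_right hne)
      have hne' : G.mult s(q, p) ≠ 0 := by rwa [Sym2.eq_swap]
      have hpq : p ≠ q := fun hpq => hne (hpq ▸ h.noLoop p)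
      refine he ?_
      clear hverts hverts' hE h1 h2 he
      rcases hp with rfl | rfl | rfl | rfl | rfl <;>
        rcases hq with rfl | rfl | rfl | rfl | rfl <;>
          first
          | exact absurd rfl hpq
          | exact absurd ‹_› hne
          | exact absurd ‹_› hne'
          | simp

end Admissible

end Multigraph

/-- **Complete reduction to two terminal graphs** (Proposition 4.10).
Let `G` be a finite connected simple graph, 3-connected to the three distinct
degree-2 vertices `x, y, z`, with all other vertices of degree 3.  Then `G` can be
transformed by a finite sequence of strong H-reductions into either the triangle
on `{x, y, z}`, or the complete bipartite graph with parts `{x, y, z}` and `{v, v'}`. -/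
theorem complete_reduction_to_terminal_graphs
    {V : Type} (G : Multigraph V) (x y z : V)
    (hxy : x ≠ y) (hxz : x ≠ z) (hyz : y ≠ z)
    (hx : x ∈ G.verts) (hy : y ∈ G.verts) (hz : z ∈ G.verts)
    (hsimple : G.IsSimple) (hconn : G.Connected)
    (h3c : G.ThreeConnTo x y z)
    (hdeg3 : ∀ v ∈ G.verts, v ≠ x → v ≠ y → v ≠ z → G.deg v = 3)
    (hdx : G.deg x = 2) (hdy : G.deg y = 2) (hdz : G.deg z = 2) :
    ∃ (k : ℕ) (Gs : ℕ → Multigraph V),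
      Gs 0 = G ∧
      (∀ i < k, ∃ a b : V,
        a ∈ (Gs i).verts ∧ b ∈ (Gs i).verts ∧
        a ≠ x ∧ a ≠ y ∧ a ≠ z ∧ b ≠ x ∧ b ≠ y ∧ b ≠ z ∧
        (Gs i).IsHReductionBy a b (Gs (i + 1)) ∧
        (Gs (i + 1)).ThreeConnTo x y z) ∧
      (((∀ v : V, v ∈ (Gs k).verts ↔ v = x ∨ v = y ∨ v = z) ∧
          (∀ e : Sym2 V, (Gs k).mult e =
            if e = s(x, y) ∨ e = s(y, z) ∨ e = s(x, z) then 1 else 0)) ∨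
       (∃ v v' : V, v ≠ v' ∧
          v ≠ x ∧ v ≠ y ∧ v ≠ z ∧ v' ≠ x ∧ v' ≠ y ∧ v' ≠ z ∧
          (∀ w : V, w ∈ (Gs k).verts ↔ w = x ∨ w = y ∨ w = z ∨ w = v ∨ w = v') ∧
          (∀ e : Sym2 V, (Gs k).mult e =
            if e = s(x, v) ∨ e = s(x, v') ∨ e = s(y, v) ∨ e = s(y, v') ∨
                e = s(z, v) ∨ e = s(z, v') then 1 else 0))) := by
  have h := Multigraph.admissible_of_threeConnTo hxy hxz hyz hx hy hz hsimple h3c hdeg3 hdx hdy hdz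
  obtain ⟨k, Gs, h0, hstep, hend, hE⟩ := h.exists_reduction_sequence
  refine ⟨k, Gs, h0, fun i hi => ?_, hend.eq_triangle_or_bipartite hxy hxz hyz hE⟩
  obtain ⟨a, ha, b, hb, hred, hadm⟩ := hstep i hi
  simp only [Finset.mem_sdiff, Finset.mem_insert, Finset.mem_singleton, not_or] at ha hb
  exact ⟨a, b, ha.1, hb.1, ha.2.1, ha.2.2.1, ha.2.2.2, hb.2.1, hb.2.2.1, hb.2.2.2, hred,
    hadm.threeConnTo hxy hxz hyz⟩
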